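/- arXiv:1511.08456 — 4 statements merged into one kernel-verified Lean document; each statement's English description precedes it below -/
import Mathlib

section
/- Let σ and σ' be memoryless strategies with identical supports, i.e., for all s ∈ S and a ∈ A one has σ(s)(a) > 0 if and only if σ'(s)(a) > 0. Then σ is almost-sure winning for Reach({G}) if and only if σ' is almost-sure winning for Reach({G}). -/
open scoped ENNReal
open Filter
open scoped Classical

/-- A POMDP with state space `S`, action alphabet `A`, observations `Z`,
probabilistic transition function, observation function, initial state and goal state. -/
structure POMDP (S A Z : Type) where
  trans : S → A → PMF S
  obs : S → Z
  init : S
  goal : S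

namespace POMDP

variable {S A Z : Type}

/-- A memoryless (observation-stationary) strategy: states with equal observations
get equal distributions over actions. -/
def Memoryless (P : POMDP S A Z) (σ : S → PMF A) : Prop :=
  ∀ s s' : S, P.obs s = P.obs s' → σ s = σ s'

/-- Finite-horizon reach probabilities `p_n` for the goal state under strategy `σ`. -/
noncomputable def preach (P : POMDP S A Z) (σ : S → PMF A) : ℕ → S → ℝ≥0∞
  | 0, s => if s = P.goal then 1 else 0
  | n + 1, s =>
      if s = P.goal then 1
      else ∑' a : A, σ s a * ∑' s' : S, P.trans s a s' * P.preach σ n s'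

/-- `σ` is almost-sure winning for `Reach({G})` iff `p_n(I) → 1`. -/
def AlmostSureWinning (P : POMDP S A Z) (σ : S → PMF A) : Prop :=
  Tendsto (fun n => P.preach σ n P.init) atTop (nhds 1)

/-- A finite path `(s₁, a₁, …, s_{k+1})` (with `k+1` states, `k` transitions)
is compatible with `σ` if each action has positive strategy probability and each
transition has positive transition probability. -/
def IsCompatPath (P : POMDP S A Z) (σ : S → PMF A) (k : ℕ)
    (st : Fin (k + 1) → S) (ac : Fin k → A) : Prop :=
  ∀ i : Fin k,
    0 < σ (st i.castSucc) (ac i) ∧ 0 < P.trans (st i.castSucc) (ac i) (st i.succ)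

/-- `R_σ`: the least set of states containing the initial state and closed under
σ-positive one-step transitions. -/
inductive ReachSet (P : POMDP S A Z) (σ : S → PMF A) : S → Prop
  | init : ReachSet P σ P.init
  | step {s s' : S} (a : A) :
      ReachSet P σ s → 0 < σ s a → 0 < P.trans s a s' → ReachSet P σ s'

end POMDP

/-- Two functions with the same finite mean under `p`, one below the other on the support of `p`,
agree on the support of `p`. -/
theorem PMF.eq_of_tsum_mul_eq_of_le {α : Type*} (p : PMF α) {f g : α → ℝ≥0∞}
    (hle : ∀ a, p a ≠ 0 → f a ≤ g a) (hfin : ∑' a, p a * f a ≠ ∞)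
    (heq : ∑' a, p a * f a = ∑' a, p a * g a) {a : α} (ha : p a ≠ 0) : f a = g a := by
  by_contra hne
  refine (ENNReal.tsum_lt_tsum (i := a) hfin (fun b => ?_) ?_).ne heq
  · by_cases hb : p b = 0
    · simp [hb]
    · exact mul_le_mul_right (hle b hb) _
  · exact (ENNReal.mul_lt_mul_iff_right ha (p.apply_ne_top a)).2 ((hle a ha).lt_of_ne hne)

namespace POMDP

variable {S A Z : Type}

/-- The one-step state distribution of the Markov chain induced by `σ`. -/
noncomputable def step (P : POMDP S A Z) (σ : S → PMF A) (s : S) : PMF S :=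
  (σ s).bind (P.trans s)

/-- The probability of eventually reaching the goal state. -/
noncomputable def reachProb (P : POMDP S A Z) (σ : S → PMF A) (s : S) : ℝ≥0∞ :=
  ⨆ n, P.preach σ n s

theorem step_apply_ne_zero_iff_of_same_support (P : POMDP S A Z) {σ σ' : S → PMF A}
    (hsupp : ∀ s a, 0 < σ s a ↔ 0 < σ' s a) (s s' : S) :
    P.step σ s s' ≠ 0 ↔ P.step σ' s s' ≠ 0 := by
  simp only [step, ← PMF.mem_support_iff, PMF.mem_support_bind_iff]
  simp only [PMF.mem_support_iff, ← pos_iff_ne_zero, hsupp]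

theorem preach_goal (P : POMDP S A Z) (σ : S → PMF A) (n : ℕ) : P.preach σ n P.goal = 1 := by
  cases n <;> simp [preach]

theorem preach_succ_of_ne_goal (P : POMDP S A Z) (σ : S → PMF A) (n : ℕ) {s : S}
    (hs : s ≠ P.goal) :
    P.preach σ (n + 1) s = ∑' s', P.step σ s s' * P.preach σ n s' := by
  simp only [preach, hs, if_false, step, PMF.bind_apply, ← ENNReal.tsum_mul_left,
    ← ENNReal.tsum_mul_right]
  rw [ENNReal.tsum_comm]
  simp only [mul_assoc]

theorem preach_le_one (P : POMDP S A Z) (σ : S → PMF A) (n : ℕ) (s : S) :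
    P.preach σ n s ≤ 1 := by
  induction n generalizing s with
  | zero => simp only [preach]; split_ifs <;> simp
  | succ n ih =>
    by_cases hs : s = P.goal
    · rw [hs, preach_goal]
    · rw [preach_succ_of_ne_goal P σ n hs, ← (P.step σ s).tsum_coe]
      exact ENNReal.tsum_le_tsum fun s' => mul_le_of_le_one_right' (ih s')

theorem monotone_preach (P : POMDP S A Z) (σ : S → PMF A) (s : S) :
    Monotone fun n => P.preach σ n s := by
  refine monotone_nat_of_le_succ fun n => ?_
  by_cases hs : s = P.goal
  · simp only [hs, preach_goal, le_refl]
  · induction n generalizing s with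
    | zero => simp [preach, hs]
    | succ n ih =>
      rw [preach_succ_of_ne_goal P σ n hs, preach_succ_of_ne_goal P σ (n + 1) hs]
      refine ENNReal.tsum_le_tsum fun s' => mul_le_mul_right ?_ _
      by_cases hs' : s' = P.goal
      · simp only [hs', preach_goal, le_refl]
      · exact ih s' hs'

theorem reachProb_goal (P : POMDP S A Z) (σ : S → PMF A) : P.reachProb σ P.goal = 1 := by
  simp [reachProb, preach_goal]

theorem reachProb_le_one (P : POMDP S A Z) (σ : S → PMF A) (s : S) : P.reachProb σ s ≤ 1 :=
  iSup_le fun n => P.preach_le_one σ n s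

theorem almostSureWinning_iff_reachProb_eq_one (P : POMDP S A Z) (σ : S → PMF A) :
    P.AlmostSureWinning σ ↔ P.reachProb σ P.init = 1 := by
  have h := tendsto_atTop_iSup (P.monotone_preach σ P.init)
  refine ⟨fun h1 => tendsto_nhds_unique h h1, fun h1 => ?_⟩
  rwa [← reachProb, h1] at h

theorem reachProb_eq_tsum_of_ne_goal [Fintype S] (P : POMDP S A Z) (σ : S → PMF A) {s : S}
    (hs : s ≠ P.goal) :
    P.reachProb σ s = ∑' s', P.step σ s s' * P.reachProb σ s' := by
  have h := fun s => tendsto_atTop_iSup (P.monotone_preach σ s)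
  refine tendsto_nhds_unique ((h s).comp (tendsto_add_atTop_nat 1)) ?_
  simp only [Function.comp_def, preach_succ_of_ne_goal P σ _ hs, tsum_fintype]
  exact tendsto_finsetSum _ fun s' _ =>
    ENNReal.Tendsto.const_mul (h s') (Or.inr ((P.step σ s).apply_ne_top s'))

/-- From a set of non-goal states that is closed under the induced chain, the goal is never
reached. -/
theorem reachProb_eq_zero_of_closed (P : POMDP S A Z) (σ : S → PMF A) {M : Set S}
    (hgoal : P.goal ∉ M) (hM : ∀ s ∈ M, ∀ s', P.step σ s s' ≠ 0 → s' ∈ M) {s : S}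
    (hs : s ∈ M) : P.reachProb σ s = 0 := by
  simp only [reachProb, ENNReal.iSup_eq_zero]
  intro n
  have hne : ∀ s ∈ M, s ≠ P.goal := fun s hs h => hgoal (h ▸ hs)
  induction n generalizing s with
  | zero => simp [preach, hne s hs]
  | succ n ih =>
    rw [preach_succ_of_ne_goal P σ n (hne s hs), ENNReal.tsum_eq_zero]
    intro s'
    by_cases h : P.step σ s s' = 0
    · simp [h]
    · simp [ih (hM s hs s' h)]

theorem reachProb_eq_one_of_step_ne_zero [Fintype S] (P : POMDP S A Z) (σ : S → PMF A) {s s' : S}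
    (hs : s ≠ P.goal) (h1 : P.reachProb σ s = 1) (hstep : P.step σ s s' ≠ 0) :
    P.reachProb σ s' = 1 := by
  have hmean := (P.reachProb_eq_tsum_of_ne_goal σ hs).symm.trans h1
  refine (P.step σ s).eq_of_tsum_mul_eq_of_le (g := fun _ => 1)
    (fun a _ => P.reachProb_le_one σ a) ?_ ?_ hstep
  · rw [hmean]
    exact ENNReal.one_ne_top
  · simp only [hmean, mul_one, PMF.tsum_coe]

/-- A state from which `σ` reaches the goal almost surely is also one for every strategy with the
same support: otherwise the states minimizing the reach probability would form a closed set that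
avoids the goal. -/
theorem reachProb_eq_one_of_same_support [Fintype S] (P : POMDP S A Z) {σ σ' : S → PMF A}
    (hsupp : ∀ s a, 0 < σ s a ↔ 0 < σ' s a) {s : S} (hs : P.reachProb σ s = 1) :
    P.reachProb σ' s = 1 := by
  obtain ⟨t, ht, hmin⟩ := Set.exists_min_image {s | P.reachProb σ s = 1} (P.reachProb σ')
    (Set.toFinite _) ⟨s, hs⟩
  suffices h : P.reachProb σ' t = 1 from
    (P.reachProb_le_one σ' s).antisymm (h ▸ hmin s hs)
  by_contra hne
  let M : Set S := {u | P.reachProb σ u = 1 ∧ P.reachProb σ' u = P.reachProb σ' t}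
  have hgoal : P.goal ∉ M := fun h => hne (h.2.symm.trans (P.reachProb_goal σ'))
  have hclosed : ∀ u ∈ M, ∀ u', P.step σ u u' ≠ 0 → u' ∈ M := by
    intro u hu u' hstep
    have hu_goal : u ≠ P.goal := fun h => hgoal (h ▸ hu)
    have hsucc : ∀ v, P.step σ u v ≠ 0 → P.reachProb σ v = 1 := fun v =>
      P.reachProb_eq_one_of_step_ne_zero σ hu_goal hu.1
    have hiff := P.step_apply_ne_zero_iff_of_same_support hsupp u
    have hmean := (P.reachProb_eq_tsum_of_ne_goal σ' hu_goal).symm.trans hu.2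
    have hconst : ∑' v, P.step σ' u v * P.reachProb σ' t = P.reachProb σ' t := by
      rw [ENNReal.tsum_mul_right, PMF.tsum_coe, one_mul]
    refine ⟨hsucc u' hstep, ?_⟩
    refine ((P.step σ' u).eq_of_tsum_mul_eq_of_le (f := fun _ => P.reachProb σ' t)
      (fun v hv => hmin v (hsucc v ((hiff v).2 hv))) ?_ (hconst.trans hmean.symm)
      ((hiff u').1 hstep)).symm
    rw [hconst]
    exact ((P.reachProb_le_one σ' t).trans_lt ENNReal.one_lt_top).ne
  have hzero := P.reachProb_eq_zero_of_closed σ hgoal hclosed (s := t) ⟨ht, rfl⟩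
  exact zero_ne_one (hzero.symm.trans ht)

end POMDP

/-- Two memoryless strategies with identical supports are equi-winning. -/
theorem winning_iff_of_same_support
    {S A Z : Type} [Fintype S] [Nonempty S] [Fintype A] [Nonempty A] [Fintype Z]
    (P : POMDP S A Z) (σ σ' : S → PMF A)
    (hσ : P.Memoryless σ) (hσ' : P.Memoryless σ')
    (hsupp : ∀ (s : S) (a : A), 0 < σ s a ↔ 0 < σ' s a) :
    P.AlmostSureWinning σ ↔ P.AlmostSureWinning σ' := by
  simp only [POMDP.almostSureWinning_iff_reachProb_eq_one]
  exact ⟨P.reachProb_eq_one_of_same_support hsupp,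
    P.reachProb_eq_one_of_same_support fun s a => (hsupp s a).symm⟩
end

section
/- A POMDP P with goal state G has a small-memory almost-sure winning strategy of size μ if and only if it has a small-memory almost-sure winning strategy of size μ in which both the action selection function and the memory update function are uniform on their supports, i.e., σ_n(m)(a) = σ_n(m)(a') whenever both are positive, and σ_u(m,z,a)(m') = σ_u(m,z,a)(m'') whenever both are positive. -/
open scoped ENNReal
open Filter
open scoped Classical

namespace POMDP

variable {S A Z : Type}

/-- Finite-horizon reach probabilities `q_n : S × M → [0,1]` for a strategy with
memory given by action selection function `σn` and memory update function `σu`. -/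
noncomputable def qreach (P : POMDP S A Z) {M : Type}
    (σn : M → PMF A) (σu : M → Z → A → PMF M) : ℕ → S → M → ℝ≥0∞
  | 0, s, _ => if s = P.goal then 1 else 0
  | n + 1, s, m =>
      if s = P.goal then 1
      else ∑' a : A, σn m a * ∑' s' : S, P.trans s a s' *
        ∑' m' : M, σu m (P.obs s) a m' * P.qreach σn σu n s' m'

/-- A finite sequence `(s₁, m₁, a₁, …, s_{k+1}, m_{k+1})` (with `k+1` state–memory
pairs) is a σ-compatible path for the strategy with memory `(σn, σu)`. -/
def IsCompatPathMem (P : POMDP S A Z) {M : Type}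
    (σn : M → PMF A) (σu : M → Z → A → PMF M) (k : ℕ)
    (st : Fin (k + 1) → S) (mem : Fin (k + 1) → M) (ac : Fin k → A) : Prop :=
  ∀ i : Fin k,
    0 < P.trans (st i.castSucc) (ac i) (st i.succ) ∧
    0 < σn (mem i.castSucc) (ac i) ∧
    0 < σu (mem i.castSucc) (P.obs (st i.castSucc)) (ac i) (mem i.succ)

end POMDP

namespace PMF

/-- The uniform distribution on the support of a distribution over a finite type. -/
noncomputable def uniformOnSupport {α : Type} [Finite α] (p : PMF α) : PMF α :=
  uniformOfFinset p.support.toFinite.toFinset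
    ((Set.Finite.toFinset_nonempty _).2 p.support_nonempty)

theorem support_uniformOnSupport {α : Type} [Finite α] (p : PMF α) :
    p.uniformOnSupport.support = p.support := by
  simp [uniformOnSupport]

theorem uniformOnSupport_eq_of_pos {α : Type} [Finite α] (p : PMF α) {a b : α}
    (ha : 0 < p.uniformOnSupport a) (hb : 0 < p.uniformOnSupport b) :
    p.uniformOnSupport a = p.uniformOnSupport b := by
  have h : ∀ x, 0 < p.uniformOnSupport x → x ∈ p.support.toFinite.toFinset := fun x hx => by
    rw [Set.Finite.mem_toFinset, ← support_uniformOnSupport]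
    exact hx.ne'
  unfold uniformOnSupport
  rw [uniformOfFinset_apply_of_mem _ (h a ha), uniformOfFinset_apply_of_mem _ (h b hb)]

theorem tsum_bind_mul {α β : Type} (p : PMF α) (k : α → PMF β) (f : β → ℝ≥0∞) :
    ∑' y, p.bind k y * f y = ∑' a, p a * ∑' y, k a y * f y := by
  simp_rw [bind_apply, ← ENNReal.tsum_mul_right, ← ENNReal.tsum_mul_left, mul_assoc]
  exact ENNReal.tsum_comm

theorem tsum_pure_mul {α : Type} (x : α) (f : α → ℝ≥0∞) :
    ∑' y, pure x y * f y = f x := by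
  rw [tsum_eq_single x fun y hy => by simp [pure_apply, hy]]
  simp

/-- The mean of a function that is at least `c` on the support, and larger than `c` somewhere on
it, is larger than `c`. -/
theorem lt_tsum_mul_of_le {α : Type} (p : PMF α) {f : α → ℝ≥0∞} {c : ℝ≥0∞} (hc : c ≠ ⊤)
    (hf : ∀ y ∈ p.support, c ≤ f y) {y : α} (hy : y ∈ p.support) (hlt : c < f y) :
    c < ∑' y, p y * f y := by
  calc c = ∑' y, p y * c := by rw [ENNReal.tsum_mul_right, p.tsum_coe, one_mul]
    _ < ∑' y, p y * f y := by
      refine ENNReal.tsum_lt_tsum (i := y) ?_ (fun z => ?_) ?_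
      · rwa [ENNReal.tsum_mul_right, p.tsum_coe, one_mul]
      · by_cases hz : p z = 0
        · simp [hz]
        · gcongr
          exact hf z hz
      · exact ENNReal.mul_lt_mul_right hy (p.apply_ne_top y) hlt

/-- The mean of a function that is at most `c`, and smaller than `c` somewhere on the support, is
smaller than `c`. -/
theorem tsum_mul_lt_of_le {α : Type} (p : PMF α) {f : α → ℝ≥0∞} {c : ℝ≥0∞} (hc : c ≠ ⊤)
    (hf : ∀ y, f y ≤ c) {y : α} (hy : y ∈ p.support) (hlt : f y < c) :
    ∑' y, p y * f y < c := by
  have hsum : ∑' y, p y * c = c := by rw [ENNReal.tsum_mul_right, p.tsum_coe, one_mul]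
  have hle : ∀ z, p z * f z ≤ p z * c := fun z => by gcongr; exact hf z
  calc ∑' y, p y * f y < ∑' y, p y * c :=
      ENNReal.tsum_lt_tsum (i := y)
        (((ENNReal.tsum_le_tsum hle).trans_eq hsum).trans_lt hc.lt_top).ne hle
        (ENNReal.mul_lt_mul_right hy (p.apply_ne_top y) hlt)
    _ = c := hsum

end PMF

/-- Probability of hitting `T` within `n` steps in the Markov chain with kernel `K`. -/
noncomputable def hitProb {X : Type} (K : X → PMF X) (T : X → Prop) : ℕ → X → ℝ≥0∞
  | 0, x => if T x then 1 else 0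
  | n + 1, x => if T x then 1 else ∑' y, K x y * hitProb K T n y

/-- States reachable from `x₀` with positive probability before hitting `T`. -/
inductive ReachBefore {X : Type} (K : X → PMF X) (T : X → Prop) (x₀ : X) : X → Prop
  | refl : ReachBefore K T x₀ x₀
  | step {x y : X} : ReachBefore K T x₀ x → ¬ T x → y ∈ (K x).support → ReachBefore K T x₀ y

namespace hitProb

variable {X : Type} {K : X → PMF X} {T : X → Prop}

theorem of_target {x : X} (hx : T x) (n : ℕ) : hitProb K T n x = 1 := by
  cases n <;> simp [hitProb, hx]

theorem succ_of_not {x : X} (hx : ¬ T x) (n : ℕ) :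
    hitProb K T (n + 1) x = ∑' y, K x y * hitProb K T n y := by
  simp [hitProb, hx]

theorem le_one (n : ℕ) (x : X) : hitProb K T n x ≤ 1 := by
  induction n generalizing x with
  | zero => unfold hitProb; split_ifs <;> simp
  | succ n ih =>
    by_cases hx : T x
    · rw [of_target hx]
    · rw [succ_of_not hx, ← (K x).tsum_coe]
      exact ENNReal.tsum_le_tsum fun y => mul_le_of_le_one_right' (ih y)

theorem le_succ (n : ℕ) (x : X) : hitProb K T n x ≤ hitProb K T (n + 1) x := by
  by_cases hx : T x
  · rw [of_target hx, of_target hx]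
  · induction n generalizing x with
    | zero => simp [hitProb, hx]
    | succ n ih =>
      rw [succ_of_not hx, succ_of_not hx]
      refine ENNReal.tsum_le_tsum fun y => ?_
      gcongr
      by_cases hy : T y
      · rw [of_target hy, of_target hy]
      · exact ih y hy

theorem mono (x : X) : Monotone fun n => hitProb K T n x :=
  monotone_nat_of_le_succ fun n => le_succ n x

theorem tendsto_one_iff (x : X) :
    Tendsto (fun n => hitProb K T n x) atTop (nhds 1) ↔ ⨆ n, hitProb K T n x = 1 :=
  ⟨fun h => tendsto_nhds_unique (tendsto_atTop_iSup (mono x)) h,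
    fun h => h ▸ tendsto_atTop_iSup (mono x)⟩

theorem iSup_of_not {x : X} (hx : ¬ T x) :
    ⨆ n, hitProb K T n x = ∑' y, K x y * ⨆ n, hitProb K T n y := by
  simp_rw [ENNReal.mul_iSup]
  rw [← (mono x).iSup_nat_add 1]
  simp_rw [succ_of_not hx]
  refine (iSup_le fun n => ?_).antisymm ?_
  · exact ENNReal.tsum_le_tsum fun y => le_iSup (fun n => K x y * hitProb K T n y) n
  · rw [ENNReal.tsum_eq_iSup_sum]
    refine iSup_le fun s => ?_
    rw [ENNReal.finsetSum_iSup_of_monotone fun y => fun a b hab => by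
      gcongr; exact mono y hab]
    exact iSup_mono fun n => ENNReal.sum_le_tsum s

theorem iSup_le_one (x : X) : ⨆ n, hitProb K T n x ≤ 1 :=
  iSup_le fun n => le_one n x

/-- A finite Markov chain hits `T` almost surely iff `T` stays accessible from every state that
is reachable before hitting `T`. -/
theorem tendsto_one_iff_forall_reach [Finite X] (x₀ : X) :
    Tendsto (fun n => hitProb K T n x₀) atTop (nhds 1) ↔
      ∀ x, ReachBefore K T x₀ x → ∃ n, 0 < hitProb K T n x := by
  rw [tendsto_one_iff]
  constructor
  · intro h x hx
    have hone : ⨆ n, hitProb K T n x = 1 := by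
      induction hx with
      | refl => exact h
      | step _ hT hy ih =>
        by_contra hne
        have hlt := (K _).tsum_mul_lt_of_le ENNReal.one_ne_top iSup_le_one hy
          (lt_of_le_of_ne (iSup_le_one _) hne)
        rw [← iSup_of_not hT, ih] at hlt
        exact hlt.false
    exact lt_iSup_iff.1 (hone ▸ zero_lt_one)
  · intro h
    obtain ⟨x, hx, hmin⟩ := Set.exists_min_image {x | ReachBefore K T x₀ x}
      (fun x => ⨆ n, hitProb K T n x) (Set.toFinite _) ⟨x₀, .refl⟩
    by_contra hne
    have hlt : ⨆ n, hitProb K T n x < 1 :=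
      (hmin x₀ .refl).trans_lt (lt_of_le_of_ne (iSup_le_one x₀) hne)
    have hzero : ∀ n y, ReachBefore K T x₀ y →
        ⨆ n, hitProb K T n y = ⨆ n, hitProb K T n x → hitProb K T n y = 0 := by
      intro n
      induction n with
      | zero =>
        intro y _ hyx
        have hT : ¬ T y := fun hT => by simp [← hyx, of_target hT] at hlt
        simp [hitProb, hT]
      | succ n ih =>
        intro y hy hyx
        have hT : ¬ T y := fun hT => by simp [← hyx, of_target hT] at hlt
        rw [succ_of_not hT, ENNReal.tsum_eq_zero]
        intro z
        by_cases hz : z ∈ (K y).support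
        · rw [ih z (hy.step hT hz), mul_zero]
          by_contra hzx
          have := (K y).lt_tsum_mul_of_le hlt.ne_top (fun w hw => hmin w (hy.step hT hw)) hz
            (lt_of_le_of_ne (hmin z (hy.step hT hz)) (Ne.symm hzx))
          rw [← iSup_of_not hT, hyx] at this
          exact this.false
        · rw [(PMF.apply_eq_zero_iff _ _).2 hz, zero_mul]
    obtain ⟨n, hn⟩ := h x hx
    exact hn.ne' (hzero n x hx rfl)

theorem pos_of_support_subset {K' : X → PMF X} (hK : ∀ x, (K x).support ⊆ (K' x).support)
    (n : ℕ) (x : X) (h : 0 < hitProb K T n x) : 0 < hitProb K' T n x := by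
  by_cases hx : T x
  · simp [of_target hx]
  · induction n generalizing x with
    | zero => simp [hitProb, hx] at h
    | succ n ih =>
      rw [succ_of_not hx, pos_iff_ne_zero, Ne, ENNReal.tsum_eq_zero, not_forall] at h ⊢
      obtain ⟨y, hy⟩ := h
      obtain ⟨hKy, hqy⟩ := mul_ne_zero_iff.1 hy
      refine ⟨y, mul_ne_zero (hK x hKy) ?_⟩
      by_cases hT : T y
      · simp [of_target hT]
      · exact (ih y (pos_iff_ne_zero.2 hqy) hT).ne'

/-- Whether a finite Markov chain hits `T` almost surely depends only on the supports. -/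
theorem tendsto_one_of_support_eq [Finite X] {K' : X → PMF X}
    (hK : ∀ x, (K x).support = (K' x).support) {x₀ : X}
    (h : Tendsto (fun n => hitProb K T n x₀) atTop (nhds 1)) :
    Tendsto (fun n => hitProb K' T n x₀) atTop (nhds 1) := by
  rw [tendsto_one_iff_forall_reach] at h ⊢
  intro x hx
  have hx' : ReachBefore K T x₀ x := by
    induction hx with
    | refl => exact .refl
    | step _ hT hy ih => exact ih.step hT (hK _ ▸ hy)
  obtain ⟨n, hn⟩ := h x hx'
  exact ⟨n, pos_of_support_subset (fun y => (hK y).subset) n x hn⟩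

end hitProb

namespace POMDP

variable {S A Z M : Type}

/-- The Markov chain on state–memory pairs induced by a strategy with memory. -/
noncomputable def memKernel (P : POMDP S A Z) (σn : M → PMF A) (σu : M → Z → A → PMF M)
    (x : S × M) : PMF (S × M) :=
  (σn x.2).bind fun a => (P.trans x.1 a).bind fun s' =>
    (σu x.2 (P.obs x.1) a).bind fun m' => PMF.pure (s', m')

theorem qreach_eq_hitProb (P : POMDP S A Z) (σn : M → PMF A) (σu : M → Z → A → PMF M)
    (n : ℕ) (s : S) (m : M) :
    P.qreach σn σu n s m = hitProb (P.memKernel σn σu) (fun x => x.1 = P.goal) n (s, m) := by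
  induction n generalizing s m with
  | zero => simp [qreach, hitProb]
  | succ n ih =>
    simp only [qreach, hitProb, memKernel, PMF.tsum_bind_mul, PMF.tsum_pure_mul, ih]

theorem support_memKernel_congr (P : POMDP S A Z) {σn τn : M → PMF A}
    {σu τu : M → Z → A → PMF M} (hn : ∀ m, (σn m).support = (τn m).support)
    (hu : ∀ m z a, (σu m z a).support = (τu m z a).support) (x : S × M) :
    (P.memKernel σn σu x).support = (P.memKernel τn τu x).support := by
  simp only [memKernel, PMF.support_bind, hn, hu]

end POMDP

/-- There is a small-memory almost-sure winning strategy of size μ iff there is one of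
size μ whose action selection and memory update functions are uniform on their supports. -/
theorem exists_smallMemory_winning_iff_exists_uniform
    {S A Z : Type} [Fintype S] [Nonempty S] [Fintype A] [Nonempty A] [Fintype Z]
    (P : POMDP S A Z) (μ : ℕ) :
    (∃ (M : Type) (_ : Finite M) (m₀ : M)
        (σn : M → PMF A) (σu : M → Z → A → PMF M),
      Nat.card M = μ ∧
      Tendsto (fun n => P.qreach σn σu n P.init m₀) atTop (nhds 1)) ↔
    (∃ (M : Type) (_ : Finite M) (m₀ : M)
        (σn : M → PMF A) (σu : M → Z → A → PMF M),
      Nat.card M = μ ∧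
      (∀ (m : M) (a a' : A), 0 < σn m a → 0 < σn m a' → σn m a = σn m a') ∧
      (∀ (m : M) (z : Z) (a : A) (m' m'' : M),
        0 < σu m z a m' → 0 < σu m z a m'' → σu m z a m' = σu m z a m'') ∧
      Tendsto (fun n => P.qreach σn σu n P.init m₀) atTop (nhds 1)) := by
  refine ⟨?_, fun ⟨M, hM, m₀, σn, σu, hcard, _, _, h⟩ => ⟨M, hM, m₀, σn, σu, hcard, h⟩⟩
  rintro ⟨M, hM, m₀, σn, σu, hcard, h⟩
  refine ⟨M, hM, m₀, fun m => (σn m).uniformOnSupport, fun m z a => (σu m z a).uniformOnSupport,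
    hcard, fun m _ _ => PMF.uniformOnSupport_eq_of_pos _,
    fun m z a _ _ => PMF.uniformOnSupport_eq_of_pos _, ?_⟩
  simp_rw [POMDP.qreach_eq_hitProb] at h ⊢
  exact hitProb.tendsto_one_of_support_eq (P.support_memKernel_congr
    (fun m => (σn m).support_uniformOnSupport.symm)
    fun m z a => (σu m z a).support_uniformOnSupport.symm) h
end

section
/- Let P be a POMDP whose goal state G is absorbing (δ(G, a)(G) = 1 for all a ∈ A), and let k ∈ ℕ. The constraint system Φ_k is satisfiable if and only if there exists a memoryless strategy σ for P such that every state s ∈ R_σ admits a σ-compatible path from s to G with at most k transitions. -/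
open scoped ENNReal
open Filter
open scoped Classical

/-- A satisfying assignment for the constraint system `Φ_k`: truth values for the
variables `A_{i,a}`, `C_i` and `P_{i,j}` (0 ≤ j ≤ k) satisfying constraints (1)–(7). -/
def SatPhi {S A Z : Type} (P : POMDP S A Z) (k : ℕ)
    (vA : S → A → Bool) (vC : S → Bool) (vP : S → ℕ → Bool) : Prop :=
  (∀ i : S, ∃ a : A, vA i a = true) ∧
  (∀ i i' : S, P.obs i = P.obs i' → ∀ a : A, (vA i a = true ↔ vA i' a = true)) ∧
  vC P.init = true ∧
  (∀ (i ℓ : S) (a : A), 0 < P.trans i a ℓ →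
    vC i = true → vA i a = true → vC ℓ = true) ∧
  (∀ i : S, (vP i 0 = true ↔ i = P.goal)) ∧
  (∀ j : ℕ, j ≤ k → vP P.goal j = true) ∧
  (∀ i : S, vC i = true → vP i k = true) ∧
  (∀ (i : S) (j : ℕ), 1 ≤ j → j ≤ k →
    (vP i j = true ↔ ∃ a : A, vA i a = true ∧
      ∃ i' : S, 0 < P.trans i a i' ∧ vP i' (j - 1) = true))

theorem PMF.exists_apply_pos {α : Type*} (p : PMF α) : ∃ a, 0 < p a := by
  obtain ⟨a, ha⟩ := p.support_nonempty
  exact ⟨a, p.apply_pos_iff a |>.2 ha⟩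

namespace POMDP

variable {S A Z : Type}

/-- The goal can be reached from `s` by exactly `n` transitions of positive probability
under `σ`. -/
def GoalIn (P : POMDP S A Z) (σ : S → PMF A) : ℕ → S → Prop
  | 0, s => s = P.goal
  | n + 1, s => ∃ a : A, 0 < σ s a ∧ ∃ s' : S, 0 < P.trans s a s' ∧ P.GoalIn σ n s'

theorem goalIn_iff_exists_path (P : POMDP S A Z) (σ : S → PMF A) (n : ℕ) (s : S) :
    P.GoalIn σ n s ↔ ∃ (st : Fin (n + 1) → S) (ac : Fin n → A),
      P.IsCompatPath σ n st ac ∧ st 0 = s ∧ st (Fin.last n) = P.goal := by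
  induction n generalizing s with
  | zero =>
    constructor
    · intro h
      exact ⟨fun _ => s, Fin.elim0, fun i => i.elim0, rfl, h⟩
    · rintro ⟨st, ac, -, rfl, h⟩
      exact h
  | succ n ih =>
    constructor
    · rintro ⟨a, ha, s', hs', h⟩
      obtain ⟨st, ac, hpath, h0, hlast⟩ := (ih s').1 h
      refine ⟨Fin.cons s st, Fin.cons a ac, ?_, rfl, ?_⟩
      · intro i
        induction i using Fin.cases with
        | zero =>
          subst h0
          exact ⟨ha, hs'⟩
        | succ i => exact hpath i
      · rw [← Fin.succ_last, Fin.cons_succ, hlast]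
    · rintro ⟨st, ac, hpath, rfl, hlast⟩
      refine ⟨ac 0, (hpath 0).1, st 1, (hpath 0).2, (ih _).2 ?_⟩
      exact ⟨fun i => st i.succ, fun i => ac i.succ, fun i => hpath i.succ, rfl, hlast⟩

theorem goalIn_goal (P : POMDP S A Z) (habs : ∀ a : A, P.trans P.goal a P.goal = 1)
    (σ : S → PMF A) (n : ℕ) : P.GoalIn σ n P.goal := by
  induction n with
  | zero => rfl
  | succ n ih =>
    obtain ⟨a, ha⟩ := (σ P.goal).exists_apply_pos
    exact ⟨a, ha, P.goal, by simp [habs], ih⟩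

theorem GoalIn.mono {P : POMDP S A Z} (habs : ∀ a : A, P.trans P.goal a P.goal = 1)
    {σ : S → PMF A} {m n : ℕ} (hmn : m ≤ n) {s : S} (h : P.GoalIn σ m s) :
    P.GoalIn σ n s := by
  induction m generalizing n s with
  | zero =>
    obtain rfl : s = P.goal := h
    exact P.goalIn_goal habs σ n
  | succ m ih =>
    obtain ⟨n, rfl⟩ := Nat.exists_eq_add_of_le' (Nat.one_le_of_lt hmn)
    obtain ⟨a, ha, s', hs', h⟩ := h
    exact ⟨a, ha, s', hs', ih (Nat.le_of_succ_le_succ hmn) h⟩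

end POMDP

/-- The Boolean variables `P_{i,j}` of a satisfying assignment are determined by any strategy
whose positive actions are those selected by the variables `A_{i,a}`. -/
theorem SatPhi.vP_eq_true_iff_goalIn {S A Z : Type} {P : POMDP S A Z} {k : ℕ}
    {vA : S → A → Bool} {vC : S → Bool} {vP : S → ℕ → Bool} (h : SatPhi P k vA vC vP)
    {σ : S → PMF A} (hσ : ∀ i a, 0 < σ i a ↔ vA i a = true) {j : ℕ} (hj : j ≤ k) (i : S) :
    vP i j = true ↔ P.GoalIn σ j i := by
  obtain ⟨-, -, -, -, h0, -, -, hstep⟩ := h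
  induction j generalizing i with
  | zero => exact h0 i
  | succ j ih =>
    simp only [hstep i (j + 1) (Nat.le_add_left 1 j) hj, Nat.add_sub_cancel, POMDP.GoalIn, hσ,
      ih (Nat.le_of_succ_le hj)]

/-- Every action set function that is nonempty and constant on observations is the support of
a memoryless strategy. -/
theorem POMDP.exists_memoryless_pos_iff {S A Z : Type} [Fintype A] (P : POMDP S A Z)
    {vA : S → A → Bool} (hne : ∀ i, ∃ a, vA i a = true)
    (hobs : ∀ i i' : S, P.obs i = P.obs i' → ∀ a : A, (vA i a = true ↔ vA i' a = true)) :
    ∃ σ : S → PMF A, P.Memoryless σ ∧ ∀ i a, 0 < σ i a ↔ vA i a = true := by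
  have hne' (i : S) : (Finset.univ.filter fun a => vA i a = true).Nonempty := by
    simpa [Finset.filter_nonempty_iff] using hne i
  refine ⟨fun i => PMF.uniformOfFinset _ (hne' i), fun s s' hs => ?_, fun i a => ?_⟩
  · simp only [hobs s s' hs]
  · rw [PMF.apply_pos_iff, PMF.mem_support_uniformOfFinset_iff]
    simp

/-- With an absorbing goal, `Φ_k` is satisfiable iff there is a memoryless strategy σ
such that every state in `R_σ` has a σ-compatible path to the goal with at most `k`
transitions. -/
theorem satPhi_iff_exists_strategy_with_short_paths
    {S A Z : Type} [Fintype S] [Nonempty S] [Fintype A] [Nonempty A] [Fintype Z]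
    (P : POMDP S A Z) (habs : ∀ a : A, P.trans P.goal a P.goal = 1) (k : ℕ) :
    (∃ (vA : S → A → Bool) (vC : S → Bool) (vP : S → ℕ → Bool),
      SatPhi P k vA vC vP) ↔
    (∃ σ : S → PMF A, P.Memoryless σ ∧
      ∀ s : S, P.ReachSet σ s →
        ∃ (k' : ℕ) (st : Fin (k' + 1) → S) (ac : Fin k' → A),
          k' ≤ k ∧ P.IsCompatPath σ k' st ac ∧
          st 0 = s ∧ st (Fin.last k') = P.goal) := by
  constructor
  · rintro ⟨vA, vC, vP, h⟩
    obtain ⟨σ, hmem, hσ⟩ := P.exists_memoryless_pos_iff h.1 h.2.1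
    have hP := fun i => (h.vP_eq_true_iff_goalIn hσ le_rfl i).1
    obtain ⟨-, -, hinit, hclosed, -, -, hCP, -⟩ := h
    refine ⟨σ, hmem, fun s hs => ?_⟩
    have hC : vC s = true := by
      induction hs with
      | init => exact hinit
      | step a _ ha hs' ih => exact hclosed _ _ a hs' ih ((hσ _ a).1 ha)
    obtain ⟨st, ac, hpath⟩ := (P.goalIn_iff_exists_path σ k s).1 (hP s (hCP s hC))
    exact ⟨k, st, ac, le_rfl, hpath⟩
  · rintro ⟨σ, hmem, hpaths⟩
    refine ⟨fun i a => decide (0 < σ i a), fun i => decide (P.ReachSet σ i),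
      fun i j => decide (P.GoalIn σ j i), ?_⟩
    simp only [SatPhi, decide_eq_true_eq]
    refine ⟨fun i => (σ i).exists_apply_pos, fun i i' hi a => by rw [hmem i i' hi],
      .init, fun i l a hl hi ha => .step a hi ha hl, fun i => Iff.rfl,
      fun j _ => P.goalIn_goal habs σ j, fun i hi => ?_, fun i j hj _ => ?_⟩
    · obtain ⟨k', st, ac, hk, hpath⟩ := hpaths i hi
      exact ((P.goalIn_iff_exists_path σ k' i).2 ⟨st, ac, hpath⟩).mono habs hk
    · obtain ⟨j, rfl⟩ := Nat.exists_eq_add_of_le' hj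
      exact Iff.rfl
end

section
/- Consider the Markov chain induced on the MDP M₃ by the strategy that always chooses action a at s₀: the state space is {s₀, U, V, G} with ν(s₀) = δ_V, ν(V) = (1/3)·δ_U + (1/3)·δ_{s₀} + (1/3)·δ_G, ν(U) = (1/2)·δ_U + (1/2)·δ_{s₀}, and ν(G) = δ_G. Then lim_{n→∞} r_n(s₀) = 1, i.e., the strategy always playing a at s₀ reaches the goal G almost surely. -/
open scoped ENNReal
open Filter
open scoped Classical

/-- Finite-horizon reach probabilities `r_n` for a finite Markov chain with transition
function `ν` and (absorbing) goal state `G`. -/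
noncomputable def mcreach {S : Type} (ν : S → PMF S) (G : S) : ℕ → S → ℝ≥0∞
  | 0, s => if s = G then 1 else 0
  | n + 1, s => if s = G then 1 else ∑' s' : S, ν s s' * mcreach ν G n s'

section ReachProbabilities

variable {S : Type} (ν : S → PMF S) (G : S)

lemma mcreach_le_one (n : ℕ) (s : S) : mcreach ν G n s ≤ 1 := by
  induction n generalizing s with
  | zero => rw [mcreach]; split_ifs <;> simp
  | succ n ih =>
    rw [mcreach]
    split_ifs
    · exact le_rfl
    · calc ∑' s', ν s s' * mcreach ν G n s' ≤ ∑' s', ν s s' :=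
            ENNReal.tsum_le_tsum fun s' => mul_le_of_le_one_right' (ih s')
        _ = 1 := (ν s).tsum_coe

lemma mcreach_goal (n : ℕ) : mcreach ν G n G = 1 := by
  cases n <;> simp [mcreach]

lemma mcreach_succ_of_ne {s : S} (hs : s ≠ G) (n : ℕ) :
    mcreach ν G (n + 1) s = ∑' s', ν s s' * mcreach ν G n s' := by
  rw [mcreach, if_neg hs]

lemma mcreach_le_succ (n : ℕ) (s : S) : mcreach ν G n s ≤ mcreach ν G (n + 1) s := by
  rcases eq_or_ne s G with rfl | hs
  · simp only [mcreach_goal, le_refl]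
  induction n generalizing s with
  | zero => simp [mcreach, hs]
  | succ n ih =>
    rw [mcreach_succ_of_ne ν G hs, mcreach_succ_of_ne ν G hs]
    refine ENNReal.tsum_le_tsum fun s' => mul_le_mul_right ?_ _
    rcases eq_or_ne s' G with rfl | hs'
    · simp only [mcreach_goal, le_refl]
    · exact ih s' hs'

lemma tendsto_mcreach_iSup (s : S) :
    Tendsto (fun n => mcreach ν G n s) atTop (nhds (⨆ n, mcreach ν G n s)) :=
  tendsto_atTop_iSup (monotone_nat_of_le_succ fun n => mcreach_le_succ ν G n s)

lemma iSup_mcreach_le_one (s : S) : ⨆ n, mcreach ν G n s ≤ 1 :=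
  iSup_le fun n => mcreach_le_one ν G n s

lemma iSup_mcreach_goal : ⨆ n, mcreach ν G n G = 1 := by
  simp only [mcreach_goal, ciSup_const]

/-- The limiting reach probabilities satisfy the one-step equation away from the goal. -/
lemma iSup_mcreach_eq_sum [Fintype S] {s : S} (hs : s ≠ G) :
    ⨆ n, mcreach ν G n s = ∑ s', ν s s' * ⨆ n, mcreach ν G n s' := by
  refine tendsto_nhds_unique ((tendsto_add_atTop_iff_nat 1).2 (tendsto_mcreach_iSup ν G s)) ?_
  simp only [mcreach_succ_of_ne ν G hs, tsum_fintype]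
  exact tendsto_finsetSum _ fun s' _ =>
    ENNReal.Tendsto.const_mul (tendsto_mcreach_iSup ν G s') (Or.inr ((ν s).apply_ne_top s'))

/-- The one-step equation for the limiting reach probabilities, read in `ℝ`. -/
lemma toReal_iSup_mcreach_eq_sum [Fintype S] {s : S} (hs : s ≠ G) :
    (⨆ n, mcreach ν G n s).toReal =
      ∑ s', (ν s s').toReal * (⨆ n, mcreach ν G n s').toReal := by
  rw [iSup_mcreach_eq_sum ν G hs, ENNReal.toReal_sum fun s' _ => ENNReal.mul_ne_top
    ((ν s).apply_ne_top s') (ne_top_of_le_ne_top ENNReal.one_ne_top (iSup_mcreach_le_one ν G s'))]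
  simp only [ENNReal.toReal_mul]

end ReachProbabilities

/-- The Markov chain induced on the MDP `M₃` by the strategy always playing action `a`
at `s₀`, with states `s₀ = 0`, `U = 1`, `V = 2`, `G = 3`: the goal `G` is reached
almost surely from `s₀`. -/
theorem mdp_M3_strategy_a_almostSure
    (ν : Fin 4 → PMF (Fin 4))
    (hs : ν 0 = PMF.pure 2)
    (hV0 : ν 2 0 = 3⁻¹) (hV1 : ν 2 1 = 3⁻¹) (hV3 : ν 2 3 = 3⁻¹)
    (hU0 : ν 1 0 = 2⁻¹) (hU1 : ν 1 1 = 2⁻¹)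
    (hG : ν 3 = PMF.pure 3) :
    Tendsto (fun n => mcreach ν 3 n 0) atTop (nhds 1) := by
  have h0 : (⨆ n, mcreach ν 3 n 0).toReal = (⨆ n, mcreach ν 3 n 2).toReal := by
    rw [toReal_iSup_mcreach_eq_sum ν 3 (s := 0) (by decide), hs,
      Finset.sum_eq_single_of_mem 2 (Finset.mem_univ _), PMF.pure_apply_self,
      ENNReal.toReal_one, one_mul]
    intro s' _ hs'
    rw [PMF.pure_apply_of_ne _ _ hs', ENNReal.toReal_zero, zero_mul]
  have h1 := toReal_iSup_mcreach_eq_sum ν 3 (s := 1) (by decide)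
  have h2 := toReal_iSup_mcreach_eq_sum ν 3 (s := 2) (by decide)
  have h3 : (⨆ n, mcreach ν 3 n 3).toReal = 1 := by simp [iSup_mcreach_goal]
  have hle : (⨆ n, mcreach ν 3 n 0).toReal ≤ 1 :=
    ENNReal.toReal_mono ENNReal.one_ne_top (iSup_mcreach_le_one ν 3 0)
  have hnonneg (s s' : Fin 4) : 0 ≤ (ν s s').toReal * (⨆ n, mcreach ν 3 n s').toReal := by
    positivity
  have hV := hnonneg 2 2
  have hU2 := hnonneg 1 2
  have hU3 := hnonneg 1 3
  have hone : (⨆ n, mcreach ν 3 n 0).toReal = 1 := by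
    simp only [Fin.sum_univ_four, hU0, hU1, hV0, hV1, hV3,
      ENNReal.toReal_inv, ENNReal.toReal_ofNat] at h1 h2
    linarith
  have hlim := tendsto_mcreach_iSup ν 3 0
  rwa [(ENNReal.toReal_eq_one_iff _).1 hone] at hlim
end
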